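/- Let n ≥ 5, G = S_n, and let H ≤ G be the stabilizer of the point n (so H ≅ S_{n−1}). Let α be an irreducible character of G whose restriction to H is reducible, i.e. [α|_H, α|_H]_H ≥ 2. Then α² contains the irreducible character χ^{(n−1,1)}, given by g ↦ (number of fixed points of g) − 1, as a constituent, and consequently diam M(G,α) ≤ 2n−2. -/

import Mathlib

open scoped BigOperators

/-- The inner product `[φ,ψ]_G = (1/|G|) ∑_{g∈G} φ(g)·conj(ψ(g))` of two complex-valued
functions on a group `G`. -/
noncomputable def charInner {G : Type} [Group G] (φ ψ : G → ℂ) : ℂ :=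
  (Nat.card G : ℂ)⁻¹ * ∑ᶠ g : G, φ g * (starRingEnd ℂ) (ψ g)

/-- `χ` is the character of some finite-dimensional complex representation of `G`. -/
def IsChar (G : Type) [Group G] (χ : G → ℂ) : Prop :=
  ∃ V : FDRep ℂ G, ∀ g, V.character g = χ g

/-- `χ` is the character of some irreducible finite-dimensional complex representation of `G`. -/
def IsIrrChar (G : Type) [Group G] (χ : G → ℂ) : Prop :=
  ∃ V : FDRep ℂ G, CategoryTheory.Simple V ∧ ∀ g, V.character g = χ g

/-- `χ` is a character of `G` afforded by a faithful (injective) representation. -/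
def IsFaithfulChar (G : Type) [Group G] (χ : G → ℂ) : Prop :=
  ∃ V : FDRep ℂ G, Function.Injective (fun g => V.ρ g) ∧ ∀ g, V.character g = χ g

/-- The McKay graph `M(G, α)` has diameter at most `d`: for every ordered pair of
irreducible characters `χ₁, χ₂` there is `0 ≤ j ≤ d` with `[α^j·χ₁, χ₂]_G ≠ 0`. -/
def McKayDiamLE (G : Type) [Group G] (α : G → ℂ) (d : ℕ) : Prop :=
  ∀ χ₁ χ₂ : G → ℂ, IsIrrChar G χ₁ → IsIrrChar G χ₂ →
    ∃ j ≤ d, charInner (α ^ j * χ₁) χ₂ ≠ 0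

open scoped ComplexOrder

open CategoryTheory

lemma FDRep.character_inv {G : Type} [Group G] [Finite G] (V : FDRep ℂ G) (g : G) :
    V.character g⁻¹ = starRingEnd ℂ (V.character g) := by
  classical
  have := Fintype.ofFinite G
  let b := Module.finBasis ℂ V
  let M : G →* Matrix _ _ ℂ := (LinearMap.toMatrixAlgEquiv b).toMulEquiv.toMonoidHom.comp V.ρ
  have hM (h : G) : V.character h = (M h).trace := LinearMap.trace_eq_matrix_trace ℂ b (V.ρ h)
  let P := ∑ h : G, (M h).conjTranspose * M h
  have hP : P.PosDef := by
    refine Matrix.posDef_sum Finset.univ_nonempty fun h _ ↦ ?_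
    refine Matrix.PosDef.conjTranspose_mul_self _ ?_
    refine Matrix.mulVec_injective_of_isUnit ?_
    exact (Group.isUnit h).map M
  have hinv : (M g).conjTranspose * P * M g = P := by
    simp only [P, Finset.mul_sum, Finset.sum_mul]
    refine Fintype.sum_equiv (Equiv.mulRight g) _ _ fun h ↦ ?_
    simp [Matrix.mul_assoc]
  have hconj : M g⁻¹ = P⁻¹ * ((M g).conjTranspose * P) := by
    have h1 : M g * M g⁻¹ = 1 := by rw [← map_mul, mul_inv_cancel, map_one]
    have h2 : P⁻¹ * P = 1 :=
      Matrix.nonsing_inv_mul _ ((Matrix.isUnit_iff_isUnit_det _).1 hP.isUnit)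
    calc M g⁻¹ = P⁻¹ * P * M g⁻¹ := by rw [h2, one_mul]
      _ = P⁻¹ * ((M g).conjTranspose * P * M g) * M g⁻¹ := by rw [hinv]
      _ = P⁻¹ * ((M g).conjTranspose * P) * (M g * M g⁻¹) := by simp only [Matrix.mul_assoc]
      _ = _ := by rw [h1, mul_one]
  have h3 : P * P⁻¹ = 1 := Matrix.mul_nonsing_inv _ ((Matrix.isUnit_iff_isUnit_det _).1 hP.isUnit)
  rw [hM, hM, hconj, Matrix.trace_mul_comm, Matrix.mul_assoc, h3, mul_one,
    Matrix.trace_conjTranspose, starRingEnd_apply]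

/-- The linear map underlying a morphism of representations. -/
def FDRep.toLinearMap {G : Type} [Group G] {V W : FDRep ℂ G} (f : V ⟶ W) : V →ₗ[ℂ] W :=
  f.hom.hom.hom

lemma FDRep.toLinearMap_comm {G : Type} [Group G] {V W : FDRep ℂ G} (f : V ⟶ W) (g : G) :
    toLinearMap f ∘ₗ V.ρ g = W.ρ g ∘ₗ toLinearMap f :=
  congrArg (fun h ↦ h.hom.hom) (f.comm g)

lemma FDRep.trace_comp_of_retract {G : Type} [Group G] {V X : FDRep ℂ G} (i : V ⟶ X)
    (p : X ⟶ V) (h : i ≫ p = 𝟙 V) (g : G) :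
    LinearMap.trace ℂ X (X.ρ g ∘ₗ toLinearMap (p ≫ i)) = V.character g := by
  have h1 : toLinearMap (p ≫ i) = toLinearMap i ∘ₗ toLinearMap p := rfl
  have h2 : toLinearMap p ∘ₗ toLinearMap i = LinearMap.id :=
    congrArg (fun f ↦ f.hom.hom.hom) h
  rw [h1, ← LinearMap.comp_assoc, ← toLinearMap_comm, LinearMap.trace_comp_comm',
    ← LinearMap.comp_assoc, h2, LinearMap.id_comp]
  rfl

lemma FDRep.character_of_isBilimit {G : Type} [Group G] {V W : FDRep ℂ G}
    (b : Limits.BinaryBicone V W) (hb : b.IsBilimit) :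
    b.pt.character = V.character + W.character := by
  ext g
  have h : LinearMap.id = toLinearMap (b.fst ≫ b.inl) + toLinearMap (b.snd ≫ b.inr) :=
    congrArg (fun f ↦ f.hom.hom.hom) (Limits.IsBilimit.binary_total hb).symm
  rw [Pi.add_apply, ← trace_comp_of_retract b.inl b.fst b.inl_fst,
    ← trace_comp_of_retract b.inr b.snd b.inr_snd, ← map_add, ← LinearMap.comp_add, ← h]
  rfl

lemma IsChar.add {G : Type} [Group G] {φ ψ : G → ℂ} (hφ : IsChar G φ) (hψ : IsChar G ψ) :
    IsChar G (φ + ψ) := by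
  obtain ⟨V, hV⟩ := hφ
  obtain ⟨W, hW⟩ := hψ
  have := Limits.HasBinaryBiproducts.of_hasBinaryProducts (C := FDRep ℂ G)
  refine ⟨V ⊞ W, fun g ↦ ?_⟩
  have := FDRep.character_of_isBilimit _ (Limits.BinaryBiproduct.isBilimit V W)
  exact (congrFun this g).trans (by simp [hV, hW])

lemma IsChar.mul {G : Type} [Group G] {φ ψ : G → ℂ} (hφ : IsChar G φ) (hψ : IsChar G ψ) :
    IsChar G (φ * ψ) := by
  obtain ⟨V, hV⟩ := hφ
  obtain ⟨W, hW⟩ := hψ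
  exact ⟨MonoidalCategory.tensorObj V W, fun g ↦ by simp [hV, hW]⟩

lemma IsIrrChar.isChar {G : Type} [Group G] {χ : G → ℂ} (hχ : IsIrrChar G χ) : IsChar G χ :=
  let ⟨V, _, hV⟩ := hχ
  ⟨V, hV⟩

lemma FDRep.isChar_sub_of_hom_ne_zero {G : Type} [Group G] [Finite G] {V X : FDRep ℂ G} [Simple V]
    (f : V ⟶ X) (hf : f ≠ 0) : IsChar G (X.character - V.character) := by
  have := mono_of_nonzero_from_simple hf
  have : IsSplitMono f := ⟨⟨Injective.factorThru (𝟙 V) f, by simp⟩⟩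
  have h := FDRep.character_of_isBilimit _
    (Limits.isBilimitBinaryBiconeOfIsSplitMonoOfCokernel (Limits.cokernelIsCokernel f))
  refine ⟨_, fun g ↦ eq_sub_of_add_eq' (congrFun h g).symm⟩

lemma charInner_eq_sum {G : Type} [Group G] [Fintype G] (φ ψ : G → ℂ) :
    charInner φ ψ = (Nat.card G : ℂ)⁻¹ * ∑ g : G, φ g * (starRingEnd ℂ) (ψ g) := by
  rw [charInner, finsum_eq_sum_of_fintype]

lemma FDRep.charInner_character {G : Type} [Group G] [Finite G] (V W : FDRep ℂ G) :
    charInner W.character V.character = Module.finrank ℂ (V ⟶ W) := by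
  have := Fintype.ofFinite G
  have := invertibleOfNonzero (Nat.cast_ne_zero.2 Nat.card_pos.ne' : (Nat.card G : ℂ) ≠ 0)
  rw [← FDRep.scalar_product_char_eq_finrank_equivariant, charInner_eq_sum]
  simp only [FDRep.character_inv]

lemma IsChar.exists_charInner_eq_natCast {G : Type} [Group G] [Finite G] {φ ψ : G → ℂ}
    (hφ : IsChar G φ) (hψ : IsChar G ψ) : ∃ k : ℕ, charInner φ ψ = k := by
  obtain ⟨V, hV⟩ := hφ
  obtain ⟨W, hW⟩ := hψ
  rw [← funext hV, ← funext hW]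
  exact ⟨_, FDRep.charInner_character _ _⟩

lemma IsChar.sub_of_charInner_ne_zero {G : Type} [Group G] [Finite G] {φ χ : G → ℂ}
    (hφ : IsChar G φ) (hχ : IsIrrChar G χ) (h : charInner φ χ ≠ 0) : IsChar G (φ - χ) := by
  obtain ⟨X, hX⟩ := hφ
  obtain ⟨V, hV, hVχ⟩ := hχ
  rw [← funext hX, ← funext hVχ] at h ⊢
  rw [FDRep.charInner_character] at h
  obtain ⟨f, hf⟩ := Module.finrank_pos_iff_exists_ne_zero.1 (Nat.pos_of_ne_zero (mod_cast h))
  exact FDRep.isChar_sub_of_hom_ne_zero f hf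

lemma isIrrChar_iff {G : Type} [Group G] [Finite G] {χ : G → ℂ} :
    IsIrrChar G χ ↔ IsChar G χ ∧ charInner χ χ = 1 := by
  have (V : FDRep ℂ G) : Simple V ↔ charInner V.character V.character = 1 := by
    rw [FDRep.simple_iff_end_is_rank_one, FDRep.charInner_character, Nat.cast_eq_one]
  constructor
  · rintro ⟨V, hs, hV⟩
    exact ⟨⟨V, hV⟩, funext hV ▸ (this V).1 hs⟩
  · rintro ⟨⟨V, hV⟩, h⟩
    exact ⟨V, (this V).2 (by rwa [funext hV]), hV⟩

lemma IsIrrChar.exists_apply_one {G : Type} [Group G] [Finite G] {χ : G → ℂ}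
    (hχ : IsIrrChar G χ) : ∃ d : ℕ, d ≠ 0 ∧ χ 1 = d := by
  have h1 := (isIrrChar_iff.1 hχ).2
  obtain ⟨V, hs, hV⟩ := hχ
  refine ⟨Module.finrank ℂ V, fun h0 ↦ ?_, by rw [← hV, FDRep.char_one]⟩
  have := Module.finrank_zero_iff.1 h0
  have : χ = 0 := by
    ext g
    rw [← hV, FDRep.character, Subsingleton.elim (V.ρ g) 0, map_zero, Pi.zero_apply]
  simp [this, charInner] at h1

/-- The character `g ↦ #{x | g • x = x}` of the permutation representation on `X`. -/
noncomputable def permChar (G X : Type) [Group G] [MulAction G X] (g : G) : ℂ :=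
  Nat.card (MulAction.fixedBy X g)

lemma isChar_permChar (G X : Type) [Group G] [MulAction G X] [Finite X] :
    IsChar G (permChar G X) := by
  classical
  have := Fintype.ofFinite X
  let ρ : Representation ℂ G (X → ℂ) :=
    { toFun g := LinearMap.funLeft ℂ ℂ (g⁻¹ • · : X → X)
      map_one' := by ext; simp [LinearMap.funLeft_apply]
      map_mul' g h := by
        refine LinearMap.ext fun f ↦ funext fun x ↦ ?_
        simp [LinearMap.funLeft_apply, mul_smul] }
  refine ⟨FDRep.of ρ, fun g ↦ ?_⟩
  change LinearMap.trace ℂ (X → ℂ) (LinearMap.funLeft ℂ ℂ (g⁻¹ • · : X → X)) = _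
  rw [LinearMap.trace_eq_matrix_trace ℂ (Pi.basisFun ℂ X), Matrix.trace, permChar,
    Nat.card_eq_fintype_card, Fintype.card_subtype]
  simp [LinearMap.funLeft_apply, Pi.single_apply, inv_smul_eq_iff, eq_comm (a := g • _)]

lemma isChar_zero (G : Type) [Group G] : IsChar G 0 := by
  let : MulAction G Empty := { smul _ x := x, one_smul _ := rfl, mul_smul _ _ _ := rfl }
  convert isChar_permChar G Empty
  ext g
  simp [permChar]

lemma isChar_one (G : Type) [Group G] : IsChar G 1 := by
  let : MulAction G Unit := { smul _ x := x, one_smul _ := rfl, mul_smul _ _ _ := rfl }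
  convert isChar_permChar G Unit
  ext g
  have : MulAction.fixedBy Unit g = Set.univ := Set.eq_univ_of_forall fun _ ↦ rfl
  simp [permChar, this]

lemma isIrrChar_one (G : Type) [Group G] [Finite G] : IsIrrChar G 1 := by
  have := Fintype.ofFinite G
  refine isIrrChar_iff.2 ⟨isChar_one G, ?_⟩
  simp [charInner_eq_sum]

lemma IsChar.pow {G : Type} [Group G] {φ : G → ℂ} (hφ : IsChar G φ) (k : ℕ) :
    IsChar G (φ ^ k) := by
  induction k with
  | zero => simpa using isChar_one G
  | succ k ih => simpa only [pow_succ] using ih.mul hφ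

lemma IsChar.pow_sub_pow {G : Type} [Group G] {φ ψ : G → ℂ} (hφ : IsChar G φ) (hψ : IsChar G ψ)
    (h : IsChar G (φ - ψ)) (k : ℕ) : IsChar G (φ ^ k - ψ ^ k) := by
  induction k with
  | zero => simpa using isChar_zero G
  | succ k ih =>
    convert (hφ.mul ih).add (h.mul (hψ.pow k)) using 1
    ring

lemma charInner_add_left {G : Type} [Group G] [Finite G] (φ ψ χ : G → ℂ) :
    charInner (φ + ψ) χ = charInner φ χ + charInner ψ χ := by
  have := Fintype.ofFinite G
  simp [charInner_eq_sum, add_mul, Finset.sum_add_distrib, mul_add]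

lemma charInner_sub_left {G : Type} [Group G] [Finite G] (φ ψ χ : G → ℂ) :
    charInner (φ - ψ) χ = charInner φ χ - charInner ψ χ :=
  eq_sub_of_add_eq (by rw [← charInner_add_left, sub_add_cancel])

lemma charInner_sub_right {G : Type} [Group G] [Finite G] (φ ψ χ : G → ℂ) :
    charInner φ (ψ - χ) = charInner φ ψ - charInner φ χ := by
  have := Fintype.ofFinite G
  simp [charInner_eq_sum, mul_sub]

lemma charInner_mul_left {G : Type} [Group G] (φ ψ χ : G → ℂ) :
    charInner (φ * ψ) χ = charInner φ (star ψ * χ) := by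
  simp [charInner, mul_assoc]

lemma charInner_permChar_one (G X : Type) [Group G] [MulAction G X] [Finite G] [Finite X] :
    charInner (permChar G X) 1 = Nat.card (MulAction.orbitRel.Quotient G X) := by
  classical
  have := Fintype.ofFinite G
  have := Fintype.ofFinite X
  have := Fintype.ofFinite (MulAction.orbitRel.Quotient G X)
  have h := MulAction.sum_card_fixedBy_eq_card_orbits_mul_card_group G X
  have hG : (Nat.card G : ℂ) ≠ 0 := Nat.cast_ne_zero.2 Nat.card_pos.ne'
  simp only [charInner_eq_sum, permChar, Pi.one_apply, map_one, mul_one]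
  rw [inv_mul_eq_iff_eq_mul₀ hG, mul_comm]
  simp only [Nat.card_eq_fintype_card]
  exact_mod_cast h

lemma star_permChar (G X : Type) [Group G] [MulAction G X] :
    star (permChar G X) = permChar G X := by
  ext g
  simp [permChar]

lemma permChar_mul_permChar (G X Y : Type) [Group G] [MulAction G X] [MulAction G Y] :
    permChar G X * permChar G Y = permChar G (X × Y) := by
  ext g
  have : MulAction.fixedBy (X × Y) g = MulAction.fixedBy X g ×ˢ MulAction.fixedBy Y g := by
    ext; simp [Prod.ext_iff]
  simp [permChar, this, Nat.card_congr (Equiv.Set.prod _ _)]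

lemma permChar_pow (G X : Type) [Group G] [MulAction G X] (k : ℕ) :
    permChar G X ^ k = permChar G (Fin k → X) := by
  ext g
  have e : MulAction.fixedBy (Fin k → X) g ≃ (Fin k → MulAction.fixedBy X g) :=
    { toFun t i := ⟨t.1 i, congrFun t.2 i⟩
      invFun t := ⟨fun i ↦ (t i).1, funext fun i ↦ (t i).2⟩ }
  rw [permChar, Nat.card_congr e, Nat.card_fun, Nat.card_fin, Nat.cast_pow, Pi.pow_apply, permChar]

/-- Frobenius reciprocity for the permutation character of a transitive action. -/
lemma charInner_permChar_of_isPretransitive {G X : Type} [Group G] [Finite G] [MulAction G X]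
    [Finite X] [MulAction.IsPretransitive G X] (x : X) (φ : G → ℂ)
    (hφ : ∀ g h, φ (h * g * h⁻¹) = φ g) :
    charInner φ (permChar G X) = charInner (fun h : MulAction.stabilizer G x ↦ φ h) 1 := by
  classical
  have := Fintype.ofFinite G
  have := Fintype.ofFinite X
  have hcard : Nat.card G = Nat.card (MulAction.stabilizer G x) * Nat.card X := by
    rw [← MulAction.index_stabilizer_of_transitive G x, Subgroup.card_mul_index]
  have hX : (Nat.card X : ℂ) ≠ 0 := by
    have : Nonempty X := ⟨x⟩
    exact Nat.cast_ne_zero.2 Nat.card_pos.ne'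
  have hsum (y : X) : (∑ g : G, if g • y = y then φ g else 0) =
      ∑ h : MulAction.stabilizer G x, φ h := by
    obtain ⟨k, rfl⟩ := MulAction.exists_smul_eq G x y
    rw [← Finset.sum_subtype (Finset.univ.filter fun g : G ↦ g • x = x) (by simp) φ,
      Finset.sum_filter]
    refine (Fintype.sum_equiv (MulAut.conj k).toEquiv _ _ fun g ↦ ?_).symm
    simp [hφ, mul_smul]
  have : ∑ g : G, φ g * permChar G X g = Nat.card X * ∑ h : MulAction.stabilizer G x, φ h := by
    rw [Nat.card_eq_fintype_card, ← nsmul_eq_mul, ← Finset.card_univ, ← Finset.sum_const,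
      ← Finset.sum_congr rfl fun y _ ↦ hsum y, Finset.sum_comm]
    refine Finset.sum_congr rfl fun g _ ↦ ?_
    rw [← Finset.sum_filter, Finset.sum_const, nsmul_eq_mul, mul_comm, permChar,
      Nat.card_eq_fintype_card, Fintype.card_subtype]
    rfl
  have hstar (g : G) : starRingEnd ℂ (permChar G X g) = permChar G X g :=
    congrFun (star_permChar G X) g
  simp only [charInner_eq_sum, hstar, this, hcard, Pi.one_apply, map_one, mul_one, Nat.cast_mul]
  rw [mul_inv, mul_assoc, inv_mul_cancel_left₀ hX]

lemma Equiv.Perm.card_orbits_prod_self (X : Type) [Nontrivial X] :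
    Nat.card (MulAction.orbitRel.Quotient (Equiv.Perm X) (X × X)) = 2 := by
  classical
  let f : MulAction.orbitRel.Quotient (Equiv.Perm X) (X × X) → Bool :=
    Quotient.lift (fun p ↦ decide (p.1 = p.2)) (by
      rintro _ p ⟨g, rfl⟩
      simp)
  have hf : Function.Bijective f := by
    constructor
    · rintro ⟨a, b⟩ ⟨c, d⟩ h
      have h : (a = b) ↔ (c = d) := by simpa [f] using h
      refine (Quotient.sound (s := MulAction.orbitRel (Equiv.Perm X) (X × X)) ?_)
      by_cases hab : a = b
      · obtain rfl := h.1 hab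
        subst hab
        exact ⟨Equiv.swap c a, by simp⟩
      · have hcd := mt h.2 hab
        have hdb : Equiv.swap c a d ≠ a := by
          rw [Ne, Equiv.swap_apply_eq_iff, Equiv.swap_apply_right]
          exact Ne.symm hcd
        refine ⟨Equiv.swap (Equiv.swap c a d) b * Equiv.swap c a, Prod.ext ?_ ?_⟩
        · simp [Equiv.swap_apply_of_ne_of_ne hdb.symm hab]
        · simp
    · obtain ⟨a, b, hab⟩ := exists_pair_ne X
      rintro (_ | _)
      · exact ⟨Quotient.mk _ (a, b), by simpa [f] using hab⟩
      · exact ⟨Quotient.mk _ (a, a), by simp [f]⟩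
  rw [Nat.card_congr (Equiv.ofBijective f hf), Nat.card_eq_fintype_card, Fintype.card_bool]

lemma charInner_permChar_one_of_isPretransitive (G X : Type) [Group G] [MulAction G X] [Finite G]
    [Finite X] [Nonempty X] [MulAction.IsPretransitive G X] : charInner (permChar G X) 1 = 1 := by
  have := (MulAction.pretransitive_iff_subsingleton_quotient G X).1 inferInstance
  have : Nonempty (MulAction.orbitRel.Quotient G X) := ⟨Quotient.mk _ (Classical.arbitrary X)⟩
  rw [charInner_permChar_one, Nat.card_eq_one_iff_unique.2 ⟨‹_›, ‹_›⟩, Nat.cast_one]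

lemma isIrrChar_permChar_sub_one (X : Type) [Finite X] [Nontrivial X] :
    IsIrrChar (Equiv.Perm X) (permChar (Equiv.Perm X) X - 1) := by
  set π := permChar (Equiv.Perm X) X with hπ
  have h1 : charInner π 1 = 1 := charInner_permChar_one_of_isPretransitive _ X
  have h1' : charInner 1 π = 1 := by
    have := charInner_mul_left 1 π 1
    rwa [hπ, star_permChar, one_mul, mul_one, h1, eq_comm] at this
  have h2 : charInner π π = 2 := by
    have := charInner_mul_left π π 1
    rw [hπ, star_permChar, mul_one, permChar_mul_permChar, charInner_permChar_one,
      Equiv.Perm.card_orbits_prod_self] at this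
    exact_mod_cast this.symm
  have h11 := (isIrrChar_iff.1 (isIrrChar_one (Equiv.Perm X))).2
  refine isIrrChar_iff.2 ⟨?_, ?_⟩
  · refine (isChar_permChar _ X).sub_of_charInner_ne_zero (isIrrChar_one _) ?_
    rw [h1]
    exact one_ne_zero
  · rw [charInner_sub_left, charInner_sub_right, charInner_sub_right, h2, h1, h1', h11]
    norm_num

lemma IsChar.conj_apply {G : Type} [Group G] {φ : G → ℂ} (hφ : IsChar G φ) (g h : G) :
    φ (h * g * h⁻¹) = φ g := by
  obtain ⟨V, hV⟩ := hφ
  rw [← hV, ← hV, FDRep.char_conj]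

/-- Characters of symmetric groups are real, as every permutation is conjugate to its inverse. -/
lemma IsChar.star_eq_of_perm {X : Type} [Finite X] {φ : Equiv.Perm X → ℂ}
    (hφ : IsChar (Equiv.Perm X) φ) : star φ = φ := by
  classical
  have := Fintype.ofFinite X
  ext g
  obtain ⟨h, hh⟩ := isConj_iff.1
    (Equiv.Perm.isConj_iff_cycleType_eq.2 (Equiv.Perm.cycleType_inv g).symm)
  have h1 := hφ.conj_apply g h
  obtain ⟨V, hV⟩ := hφ
  rw [hh, ← hV, FDRep.character_inv, hV] at h1
  exact h1

/-- The permutation character on `n - 1`-tuples splits off a function supported at the identity. -/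
lemma exists_isChar_permChar_pow_sub (n : ℕ) :
    ∃ ρ : Equiv.Perm (Fin n) → ℂ, (∀ g ≠ 1, ρ g = 0) ∧ 0 < ρ 1 ∧
      IsChar (Equiv.Perm (Fin n)) (permChar (Equiv.Perm (Fin n)) (Fin n) ^ (n - 1) - ρ) := by
  classical
  let N : SubMulAction (Equiv.Perm (Fin n)) (Fin (n - 1) → Fin n) :=
    { carrier := {t | ¬ Function.Injective t}
      smul_mem' g t ht h := ht ((g.injective.of_comp_iff t).1 h) }
  let ρ (g : Equiv.Perm (Fin n)) : ℂ :=
    (Finset.univ.filter fun t : Fin (n - 1) → Fin n ↦ g • t = t ∧ Function.Injective t).card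
  refine ⟨ρ, fun g hg ↦ ?_, ?_, ?_⟩
  · rw [Nat.cast_eq_zero, Finset.card_eq_zero, Finset.filter_eq_empty_iff]
    rintro t - ⟨hgt, ht⟩
    have h2 := Equiv.Perm.two_le_card_support_of_ne_one hg
    have hdisj : Disjoint g.support (Finset.univ.image t) := by
      rw [Finset.disjoint_right]
      intro x hx
      obtain ⟨i, -, rfl⟩ := Finset.mem_image.1 hx
      rw [Equiv.Perm.notMem_support]
      exact congrFun hgt i
    have := (Finset.card_union_of_disjoint hdisj).symm.trans_le (Finset.card_le_univ _)
    rw [Finset.card_image_of_injective _ ht, Finset.card_univ, Fintype.card_fin,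
      Fintype.card_fin] at this
    omega
  · rw [Nat.cast_pos, Finset.card_pos]
    exact ⟨Fin.castLE (Nat.sub_le n 1), by simp [Fin.castLE_injective]⟩
  · convert isChar_permChar (Equiv.Perm (Fin n)) N
    ext g
    have e : MulAction.fixedBy N g ≃
        {t : Fin (n - 1) → Fin n // g • t = t ∧ ¬ Function.Injective t} :=
      { toFun t := ⟨t.1.1, congrArg Subtype.val t.2, t.1.2⟩
        invFun t := ⟨⟨t.1, t.2.2⟩, Subtype.ext t.2.1⟩ }
    have e' : Nat.card (MulAction.fixedBy (Fin (n - 1) → Fin n) g) =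
        (Finset.univ.filter fun t : Fin (n - 1) → Fin n ↦ g • t = t).card := by
      rw [Nat.card_eq_fintype_card]
      exact Fintype.card_subtype _
    rw [permChar_pow, Pi.sub_apply, permChar, permChar, Nat.card_congr e, e', sub_eq_iff_eq_add',
      Nat.card_eq_fintype_card, Fintype.card_subtype, ← Finset.filter_filter]
    simp only [ρ]
    rw [← Finset.filter_filter, ← Nat.cast_add, Finset.card_filter_add_card_filter_not]

/-- A character that dominates a function supported at the identity connects all irreducible
characters. -/
lemma charInner_mul_ne_zero_of_isChar_sub {G : Type} [Group G] [Finite G] {φ ρ χ₁ χ₂ : G → ℂ}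
    (hρ : ∀ g ≠ 1, ρ g = 0) (hρ1 : 0 < ρ 1) (h : IsChar G (φ - ρ)) (h₁ : IsIrrChar G χ₁)
    (h₂ : IsIrrChar G χ₂) : charInner (φ * χ₁) χ₂ ≠ 0 := by
  have := Fintype.ofFinite G
  obtain ⟨d₁, hd₁, e₁⟩ := h₁.exists_apply_one
  obtain ⟨d₂, hd₂, e₂⟩ := h₂.exists_apply_one
  obtain ⟨k, hk⟩ := (h.mul h₁.isChar).exists_charInner_eq_natCast h₂.isChar
  have hφ : φ * χ₁ = (φ - ρ) * χ₁ + ρ * χ₁ := by ring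
  have hρχ : charInner (ρ * χ₁) χ₂ = (Nat.card G : ℂ)⁻¹ * (ρ 1 * d₁ * d₂) := by
    rw [charInner_eq_sum, Fintype.sum_eq_single 1 fun g hg ↦ by simp [hρ g hg]]
    simp [e₁, e₂]
  rw [hφ, charInner_add_left, hk, hρχ]
  have hG : (0 : ℂ) < Nat.card G := Nat.cast_pos.2 Nat.card_pos
  have hd₁' : (0 : ℂ) < d₁ := Nat.cast_pos.2 (Nat.pos_of_ne_zero hd₁)
  have hd₂' : (0 : ℂ) < d₂ := Nat.cast_pos.2 (Nat.pos_of_ne_zero hd₂)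
  have hpos : (0 : ℂ) < (Nat.card G : ℂ)⁻¹ * (ρ 1 * d₁ * d₂) := by positivity
  exact (add_pos_of_nonneg_of_pos (Nat.cast_nonneg k) hpos).ne'

/-- **Step 2.** For `n ≥ 5`, `G = S_n` and `H` the stabilizer of the point `n` (so
`H ≅ S_{n−1}`), if `α ∈ Irr(G)` restricts reducibly to `H`, then `α²` contains
`χ^{(n−1,1)} : g ↦ #fix(g) − 1` as a constituent, and `diam M(G,α) ≤ 2n − 2`. -/
theorem mckay_diam_of_reducible_restriction (n : ℕ) (hn : 5 ≤ n)
    (H : Subgroup (Equiv.Perm (Fin n)))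
    (hH : H = MulAction.stabilizer (Equiv.Perm (Fin n)) (⟨n - 1, by omega⟩ : Fin n))
    (α : Equiv.Perm (Fin n) → ℂ) (hα : IsIrrChar (Equiv.Perm (Fin n)) α)
    (hred : 2 ≤ charInner (fun h : H => α ↑h) (fun h : H => α ↑h)) :
    charInner (α ^ 2)
        (fun g => ((Finset.univ.filter fun x : Fin n => g x = x).card : ℂ) - 1) ≠ 0 ∧
      McKayDiamLE (Equiv.Perm (Fin n)) α (2 * n - 2) := by
  subst hH
  have : Nontrivial (Fin n) := Fin.nontrivial_iff_two_le.2 (by omega)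
  set π := permChar (Equiv.Perm (Fin n)) (Fin n)
  have hχ : (fun g : Equiv.Perm (Fin n) ↦
      ((Finset.univ.filter fun x : Fin n ↦ g x = x).card : ℂ) - 1) = π - 1 := by
    ext g
    rw [Pi.sub_apply, Pi.one_apply]
    congr 2
    rw [Nat.card_eq_fintype_card]
    exact (Fintype.card_subtype _).symm
  have hstar := hα.isChar.star_eq_of_perm
  have hαsq : IsChar (Equiv.Perm (Fin n)) (α ^ 2) := hα.isChar.pow 2
  have hsq_one : charInner (α ^ 2) 1 = 1 := by
    rw [pow_two, charInner_mul_left, hstar, mul_one, (isIrrChar_iff.1 hα).2]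
  have hsq_π : 2 ≤ charInner (α ^ 2) π := by
    refine hred.trans_eq ?_
    rw [charInner_permChar_of_isPretransitive (⟨n - 1, by omega⟩ : Fin n) _
      fun g h ↦ hαsq.conj_apply g h]
    have hconj (g : Equiv.Perm (Fin n)) : starRingEnd ℂ (α g) = α g := congrFun hstar g
    simp [charInner, hconj, pow_two]
  have hsq_χ : charInner (α ^ 2) (π - 1) ≠ 0 := by
    rw [charInner_sub_right, hsq_one, sub_ne_zero]
    intro h
    rw [h] at hsq_π
    norm_num at hsq_π
  refine ⟨hχ ▸ hsq_χ, fun χ₁ χ₂ h₁ h₂ ↦ ⟨2 * n - 2, le_rfl, ?_⟩⟩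
  have hπ_irr := isIrrChar_permChar_sub_one (Fin n)
  have hπ_one : charInner π 1 = 1 := charInner_permChar_one_of_isPretransitive _ (Fin n)
  have hsub_χ : IsChar (Equiv.Perm (Fin n)) (α ^ 2 - (π - 1)) :=
    hαsq.sub_of_charInner_ne_zero hπ_irr hsq_χ
  have hsub_π : IsChar (Equiv.Perm (Fin n)) (α ^ 2 - π) := by
    have h : charInner (α ^ 2 - (π - 1)) 1 = 1 := by
      rw [charInner_sub_left, charInner_sub_left, hsq_one, hπ_one,
        (isIrrChar_iff.1 (isIrrChar_one _)).2, sub_self, sub_zero]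
    convert hsub_χ.sub_of_charInner_ne_zero (isIrrChar_one _) (h ▸ one_ne_zero) using 1
    ring
  obtain ⟨ρ, hρ, hρ1, hρπ⟩ := exists_isChar_permChar_pow_sub n
  refine charInner_mul_ne_zero_of_isChar_sub hρ hρ1 ?_ h₁ h₂
  convert (hαsq.pow_sub_pow (isChar_permChar _ (Fin n)) hsub_π (n - 1)).add hρπ using 1
  rw [show 2 * n - 2 = 2 * (n - 1) by omega, pow_mul]
  ring
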